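/- arXiv:2307.05834 — 2 statements merged into one kernel-verified Lean document; each statement's English description precedes it below -/
import Mathlib

section
/- Let M ≥ 1 be a natural number, δ ∈ (0,1), and let n be a natural number with (n : ℝ) ≥ 6·M·log(M/δ). Consider the product probability measure on (Fin M)^(Fin n) in which each of the n coordinates is an independent uniform draw from Fin M. Then the probability of the event { x : ∀ m ∈ Fin M, ∃ i ∈ Fin n, x i = m } (i.e., every task is assigned at least once) is at least 1 − δ. -/
open MeasureTheory
open scoped ENNReal

lemma isProbabilityMeasure_uniform_fin {M : ℕ} (hM : 1 ≤ M) :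
    IsProbabilityMeasure ((M : ℝ≥0∞)⁻¹ • Measure.count : Measure (Fin M)) := by
  refine ⟨?_⟩
  have h0 : (M : ℝ≥0∞) ≠ 0 := by exact_mod_cast (by lia : M ≠ 0)
  simp [Measure.count_univ, ENNReal.inv_mul_cancel h0 (ENNReal.natCast_ne_top M)]

lemma uniform_fin_compl_singleton {M : ℕ} (hM : 1 ≤ M) (m : Fin M) :
    ((M : ℝ≥0∞)⁻¹ • Measure.count : Measure (Fin M)) {m}ᶜ = ENNReal.ofReal (1 - (M : ℝ)⁻¹) := by
  have := isProbabilityMeasure_uniform_fin hM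
  have hpos : (0 : ℝ) < M := by exact_mod_cast hM
  rw [prob_compl_eq_one_sub (measurableSet_singleton m),
    ENNReal.ofReal_sub _ (inv_nonneg.2 hpos.le), ENNReal.ofReal_one,
    ENNReal.ofReal_inv_of_pos hpos, ENNReal.ofReal_natCast]
  simp

/-- The union bound over the `M` tasks is at most `δ` once `n ≥ M log (M / δ)`. -/
lemma mul_one_sub_inv_pow_le {M n : ℕ} (hM : 1 ≤ M) {δ : ℝ} (hδ : 0 < δ)
    (hn : M * Real.log (M / δ) ≤ n) : M * (1 - (M : ℝ)⁻¹) ^ n ≤ δ := by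
  have hpos : (0 : ℝ) < M := by exact_mod_cast hM
  have hbase : 0 ≤ 1 - (M : ℝ)⁻¹ := sub_nonneg.2 (inv_le_one_of_one_le₀ (by exact_mod_cast hM))
  calc M * (1 - (M : ℝ)⁻¹) ^ n
      ≤ M * Real.exp (-(M : ℝ)⁻¹) ^ n := by
        gcongr
        exact Real.one_sub_le_exp_neg _
    _ = M * Real.exp (-(n / M)) := by
        rw [← Real.exp_nat_mul, div_eq_mul_inv, mul_neg]
    _ ≤ M * Real.exp (-Real.log (M / δ)) := by
        gcongr
        rwa [le_div_iff₀' hpos]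
    _ = δ := by
        rw [Real.exp_neg, Real.exp_log (by positivity)]
        field_simp

/-- Probabilistic core of Lemma 3.4: if `n ≥ 6 M log(M/δ)` tasks are drawn
i.i.d. uniformly from `M` tasks, then with probability at least `1 - δ`
every task is assigned at least once. -/
theorem all_tasks_assigned
    (M : ℕ) (hM : 1 ≤ M) (δ : ℝ) (hδ : δ ∈ Set.Ioo (0 : ℝ) 1)
    (n : ℕ) (hn : (n : ℝ) ≥ 6 * M * Real.log (M / δ)) :
    ENNReal.ofReal (1 - δ) ≤
      Measure.pi (fun _ : Fin n => ((M : ℝ≥0∞)⁻¹ • Measure.count : Measure (Fin M)))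
        { x : Fin n → Fin M | ∀ m : Fin M, ∃ i : Fin n, x i = m } := by
  have := isProbabilityMeasure_uniform_fin hM
  set P := Measure.pi (fun _ : Fin n => ((M : ℝ≥0∞)⁻¹ • Measure.count : Measure (Fin M)))
    with hP
  set S := { x : Fin n → Fin M | ∀ m : Fin M, ∃ i : Fin n, x i = m } with hS
  have hM' : (1 : ℝ) ≤ M := by exact_mod_cast hM
  have hbase : 0 ≤ 1 - (M : ℝ)⁻¹ := sub_nonneg.2 (inv_le_one_of_one_le₀ hM')
  have hlog : 0 ≤ M * Real.log (M / δ) :=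
    mul_nonneg (by positivity)
      (Real.log_nonneg ((one_le_div hδ.1).2 (hδ.2.le.trans hM')))
  have hcompl : Sᶜ = ⋃ m : Fin M, Set.univ.pi fun _ : Fin n => ({m}ᶜ : Set (Fin M)) := by
    ext x
    simp [hS]
  have hbad : P Sᶜ ≤ ENNReal.ofReal δ := calc
    P Sᶜ ≤ ∑ m : Fin M, P (Set.univ.pi fun _ : Fin n => ({m}ᶜ : Set (Fin M))) := by
        rw [hcompl]
        exact measure_iUnion_fintype_le _ _
    _ = ENNReal.ofReal (M * (1 - (M : ℝ)⁻¹) ^ n) := by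
        simp only [hP, Measure.pi_pi, uniform_fin_compl_singleton hM, Finset.prod_const,
          Finset.sum_const, Finset.card_univ, Fintype.card_fin, nsmul_eq_mul]
        rw [ENNReal.ofReal_mul (by positivity), ENNReal.ofReal_natCast, ENNReal.ofReal_pow hbase]
    _ ≤ ENNReal.ofReal δ :=
        ENNReal.ofReal_le_ofReal (mul_one_sub_inv_pow_le hM hδ.1 (by linarith))
  rw [ENNReal.ofReal_sub _ hδ.1.le, ENNReal.ofReal_one, ← compl_compl S,
    prob_compl_eq_one_sub Sᶜ.toFinite.measurableSet]
  exact tsub_le_tsub_left hbad 1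
end

section
/- Let d ≥ 1, let S be a set, A a nonempty set, φ : S × A → ℝ^d a map with ‖φ(s,a)‖₂ ≤ 1 for all (s,a), and H > 0. For y ∈ ℝ^d and a symmetric positive semidefinite d×d real matrix Y, define V_{y,Y} : S → ℝ by V_{y,Y}(s) = min{ sup_{a∈A} ( ⟨y, φ(s,a)⟩ + √(φ(s,a)ᵀ Y φ(s,a)) ), H }. Let y₀ ≥ 0, B ≥ 0, λ > 0, ε > 0, and let 𝒱 = { V_{y,Y} : ‖y‖₂ ≤ y₀ and ‖Y‖_op ≤ B²/λ }. Then there exists a finite set 𝒩 of functions from S to ℝ with cardinality at most (1 + 4y₀/ε)^d · (1 + 8B²√d/(λε²))^{d²} such that for every V ∈ 𝒱 there is V′ ∈ 𝒩 with sup_{s∈S} |V(s) − V′(s)| ≤ ε; equivalently, the ε-covering number N_ε(𝒱) of 𝒱 in the sup distance dist(V,V′) = sup_s |V(s) − V′(s)| satisfies log N_ε(𝒱) ≤ d·log(1 + 4y₀/ε) + d²·log(1 + 8B²√d/(λε²)). -/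
open scoped RealInnerProductSpace

open Metric MeasureTheory Module

/-- Volumetric bound on the size of a `δ`-separated subset of a ball of radius `R`. -/
theorem card_le_of_separated_closedBall {E : Type*} [NormedAddCommGroup E] [NormedSpace ℝ E]
    [FiniteDimensional ℝ E] {R δ : ℝ} (hR : 0 ≤ R) (hδ : 0 < δ) (s : Finset E)
    (hs : ∀ x ∈ s, ‖x‖ ≤ R) (hsep : ∀ x ∈ s, ∀ y ∈ s, x ≠ y → δ ≤ dist x y) :
    (s.card : ℝ) ≤ (1 + 2 * R / δ) ^ finrank ℝ E := by
  borelize E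
  let μ : Measure E := Measure.addHaar
  have hr : 0 < δ / 2 := by positivity
  have hρ : 0 < R + δ / 2 := by positivity
  have disj : Set.Pairwise (s : Set E) (Function.onFun Disjoint fun x => ball x (δ / 2)) := by
    intro x hx y hy hxy
    exact ball_disjoint_ball (by linarith [hsep x hx y hy hxy])
  have sub : (⋃ x ∈ s, ball x (δ / 2)) ⊆ ball (0 : E) (R + δ / 2) :=
    Set.iUnion₂_subset fun x hx => ball_subset_ball' (by
      rw [dist_zero_right]
      linarith [hs x hx])
  have vol : (s.card : ENNReal) * ENNReal.ofReal ((δ / 2) ^ finrank ℝ E) * μ (ball 0 1) ≤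
      ENNReal.ofReal ((R + δ / 2) ^ finrank ℝ E) * μ (ball 0 1) :=
    calc
      _ = μ (⋃ x ∈ s, ball x (δ / 2)) := by
        rw [measure_biUnion_finset disj fun x _ => measurableSet_ball]
        simp only [μ.addHaar_ball_of_pos _ hr, Finset.sum_const, nsmul_eq_mul, mul_assoc]
      _ ≤ μ (ball (0 : E) (R + δ / 2)) := measure_mono sub
      _ = _ := μ.addHaar_ball_of_pos _ hρ
  have le := (ENNReal.mul_le_mul_iff_left (measure_ball_pos _ _ zero_lt_one).ne'
    measure_ball_lt_top.ne).1 vol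
  have le_real := ENNReal.toReal_le_of_le_ofReal (pow_nonneg hρ.le _) le
  rw [ENNReal.toReal_mul, ENNReal.toReal_natCast, ENNReal.toReal_ofReal (by positivity),
    ← le_div_iff₀ (by positivity), ← div_pow] at le_real
  convert! le_real using 2
  field_simp
  ring

/-- A ball of radius `R` has a `δ`-net with at most `(1 + 2R/δ)^dim` points. -/
theorem exists_finset_net_closedBall (E : Type*) [NormedAddCommGroup E] [NormedSpace ℝ E]
    [FiniteDimensional ℝ E] {R δ : ℝ} (hR : 0 ≤ R) (hδ : 0 < δ) :
    ∃ s : Finset E, (s.card : ℝ) ≤ (1 + 2 * R / δ) ^ finrank ℝ E ∧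
      ∀ x : E, ‖x‖ ≤ R → ∃ y ∈ s, ‖x - y‖ ≤ δ := by
  classical
  let P : Set (Finset E) :=
    {s | (∀ x ∈ s, ‖x‖ ≤ R) ∧ ∀ x ∈ s, ∀ y ∈ s, x ≠ y → δ ≤ dist x y}
  have card_le : ∀ s ∈ P, (s.card : ℝ) ≤ (1 + 2 * R / δ) ^ finrank ℝ E := fun s hs =>
    card_le_of_separated_closedBall hR hδ s hs.1 hs.2
  have bdd : BddAbove (Finset.card '' P) := by
    refine ⟨⌊(1 + 2 * R / δ) ^ finrank ℝ E⌋₊, ?_⟩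
    rintro _ ⟨s, hs, rfl⟩
    exact Nat.le_floor (card_le s hs)
  have ne : (Finset.card '' P).Nonempty := ⟨_, ∅, by simp [P], rfl⟩
  obtain ⟨s, hs, hmax⟩ := Nat.sSup_mem ne bdd
  refine ⟨s, card_le s hs, fun x hx => ?_⟩
  by_contra! hfar
  have hxs : x ∉ s := fun h => by
    have := hfar x h
    rw [sub_self, norm_zero] at this
    exact this.not_ge hδ.le
  have hins : insert x s ∈ P := by
    refine ⟨fun y hy => ?_, fun y hy z hz hyz => ?_⟩
    · rcases Finset.mem_insert.1 hy with rfl | hy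
      exacts [hx, hs.1 y hy]
    · rcases Finset.mem_insert.1 hy with rfl | hys <;>
        rcases Finset.mem_insert.1 hz with rfl | hzs
      · exact absurd rfl hyz
      · exact dist_eq_norm y z ▸ (hfar z hzs).le
      · exact dist_comm y z ▸ dist_eq_norm z y ▸ (hfar y hys).le
      · exact hs.2 y hys z hzs hyz
  have := le_csSup bdd (Set.mem_image_of_mem _ hins)
  rw [← hmax, Finset.card_insert_of_notMem hxs] at this
  omega

theorem finrank_continuousLinearMap_euclideanSpace (d : ℕ) :
    finrank ℝ (EuclideanSpace ℝ (Fin d) →L[ℝ] EuclideanSpace ℝ (Fin d)) = d ^ 2 := by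
  rw [← (LinearMap.toContinuousLinearMap (𝕜 := ℝ) (E := EuclideanSpace ℝ (Fin d))
    (F' := EuclideanSpace ℝ (Fin d))).finrank_eq, finrank_linearMap, finrank_euclideanSpace_fin,
    sq]

theorem Real.sqrt_le_sqrt_add_sqrt_abs_sub (a b : ℝ) : √a ≤ √b + √|a - b| := by
  rw [Real.sqrt_le_left (by positivity)]
  have hb : b ≤ √b ^ 2 := (Real.sqrt_le_left (Real.sqrt_nonneg b)).1 le_rfl
  nlinarith [Real.sq_sqrt (abs_nonneg (a - b)), le_abs_self (a - b),
    mul_nonneg (Real.sqrt_nonneg b) (Real.sqrt_nonneg |a - b|)]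

theorem Real.abs_sqrt_sub_sqrt_le (a b : ℝ) : |√a - √b| ≤ √|a - b| := by
  rw [abs_sub_le_iff]
  constructor
  · linarith [Real.sqrt_le_sqrt_add_sqrt_abs_sub a b]
  · rw [abs_sub_comm]
    linarith [Real.sqrt_le_sqrt_add_sqrt_abs_sub b a]

theorem Real.abs_iSup_sub_iSup_le {ι : Type*} [Nonempty ι] {f g : ι → ℝ} {ε : ℝ}
    (hf : BddAbove (Set.range f)) (hg : BddAbove (Set.range g)) (h : ∀ i, |f i - g i| ≤ ε) :
    |(⨆ i, f i) - ⨆ i, g i| ≤ ε := by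
  rw [abs_sub_le_iff, sub_le_iff_le_add, sub_le_iff_le_add]
  constructor
  · exact ciSup_le fun i => by linarith [(abs_sub_le_iff.1 (h i)).1, le_ciSup hg i]
  · exact ciSup_le fun i => by linarith [(abs_sub_le_iff.1 (h i)).2, le_ciSup hf i]

section Bonus

variable {E : Type*} [NormedAddCommGroup E] [InnerProductSpace ℝ E]

theorem abs_inner_apply_self_le {v : E} (hv : ‖v‖ ≤ 1) (T : E →L[ℝ] E) : |⟪v, T v⟫| ≤ ‖T‖ :=
  calc
    |⟪v, T v⟫| ≤ ‖v‖ * ‖T v‖ := abs_real_inner_le_norm _ _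
    _ ≤ 1 * (‖T‖ * 1) := by
      gcongr
      exact (T.le_opNorm v).trans (by gcongr)
    _ = ‖T‖ := by ring

theorem abs_inner_add_sqrt_sub_le {v : E} (hv : ‖v‖ ≤ 1) (y z : E) (T U : E →L[ℝ] E) :
    |(⟪y, v⟫ + √⟪v, T v⟫) - (⟪z, v⟫ + √⟪v, U v⟫)| ≤ ‖y - z‖ + √‖T - U‖ := by
  have linear : |⟪y, v⟫ - ⟪z, v⟫| ≤ ‖y - z‖ := by
    rw [← inner_sub_left]
    exact (abs_real_inner_le_norm _ _).trans (mul_le_of_le_one_right (norm_nonneg _) hv)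
  have bonus : |√⟪v, T v⟫ - √⟪v, U v⟫| ≤ √‖T - U‖ := by
    refine (Real.abs_sqrt_sub_sqrt_le _ _).trans (Real.sqrt_le_sqrt ?_)
    rw [← inner_sub_right, ← sub_apply]
    exact abs_inner_apply_self_le hv _
  rw [add_sub_add_comm]
  exact (abs_add_le _ _).trans (add_le_add linear bonus)

theorem bddAbove_range_inner_add_sqrt {A : Type*} {ψ : A → E} (hψ : ∀ a, ‖ψ a‖ ≤ 1) (y : E)
    (T : E →L[ℝ] E) : BddAbove (Set.range fun a => ⟪y, ψ a⟫ + √⟪ψ a, T (ψ a)⟫) := by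
  refine ⟨‖y‖ + √‖T‖, ?_⟩
  rintro _ ⟨a, rfl⟩
  have := abs_inner_add_sqrt_sub_le (hψ a) y 0 T 0
  simp only [inner_zero_left, inner_zero_right, zero_apply, Real.sqrt_zero,
    add_zero, sub_zero] at this
  exact (le_abs_self _).trans this

end Bonus

/-- Lemma B.3: covering number of the class of optimistic value functions
`V_{y,Y}(s) = min (sup_a (⟨y, φ(s,a)⟩ + √(φ(s,a)ᵀ Y φ(s,a)))) H` with
`‖y‖₂ ≤ y₀` and `‖Y‖_op ≤ B²/λ`: there is an `ε`-net in sup distance of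
cardinality at most `(1 + 4y₀/ε)^d · (1 + 8B²√d/(λε²))^(d²)`. -/
theorem covering_number_value_class
    (d : ℕ) (hd : 1 ≤ d) (S A : Type*) [Nonempty A]
    (φ : S → A → EuclideanSpace ℝ (Fin d)) (hφ : ∀ s a, ‖φ s a‖ ≤ 1)
    (H : ℝ) (hH : 0 < H)
    (y₀ B lam ε : ℝ) (hy₀ : 0 ≤ y₀) (hB : 0 ≤ B) (hlam : 0 < lam) (hε : 0 < ε) :
    ∃ 𝒩 : Finset (S → ℝ),
      (𝒩.card : ℝ) ≤ (1 + 4 * y₀ / ε) ^ d * (1 + 8 * B ^ 2 * Real.sqrt d / (lam * ε ^ 2)) ^ (d ^ 2) ∧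
      ∀ (y : EuclideanSpace ℝ (Fin d)) (Y : Matrix (Fin d) (Fin d) ℝ),
        Y.IsSymm → Y.PosSemidef →
        ‖y‖ ≤ y₀ → ‖Matrix.toEuclideanCLM (𝕜 := ℝ) Y‖ ≤ B ^ 2 / lam →
        ∃ V' ∈ 𝒩, ∀ s : S,
          |min (⨆ a : A, (⟪y, φ s a⟫ + Real.sqrt (⟪φ s a, (Matrix.toEuclideanCLM (𝕜 := ℝ) Y) (φ s a)⟫))) H
            - V' s| ≤ ε := by
  classical
  have one_le_sqrt_d : (1 : ℝ) ≤ √d := Real.one_le_sqrt.2 (by exact_mod_cast hd)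
  obtain ⟨N, hNcard, hN⟩ :=
    exists_finset_net_closedBall (EuclideanSpace ℝ (Fin d)) hy₀ (half_pos hε)
  obtain ⟨M, hMcard, hM⟩ := exists_finset_net_closedBall
    (EuclideanSpace ℝ (Fin d) →L[ℝ] EuclideanSpace ℝ (Fin d))
    (R := B ^ 2 / lam) (δ := (ε / 2) ^ 2) (by positivity) (by positivity)
  rw [finrank_euclideanSpace_fin] at hNcard
  rw [finrank_continuousLinearMap_euclideanSpace] at hMcard
  let V (p : EuclideanSpace ℝ (Fin d) × (EuclideanSpace ℝ (Fin d) →L[ℝ] EuclideanSpace ℝ (Fin d)))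
      (s : S) : ℝ := min (⨆ a : A, (⟪p.1, φ s a⟫ + √⟪φ s a, p.2 (φ s a)⟫)) H
  refine ⟨(N ×ˢ M).image V, ?_, fun y Y _ _ hy hY => ?_⟩
  · calc
      (((N ×ˢ M).image V).card : ℝ) ≤ (N.card : ℝ) * M.card := by
        exact_mod_cast Finset.card_image_le.trans_eq (Finset.card_product N M)
      _ ≤ (1 + 2 * y₀ / (ε / 2)) ^ d * (1 + 2 * (B ^ 2 / lam) / (ε / 2) ^ 2) ^ (d ^ 2) := by
        gcongr
      _ ≤ _ := by
        gcongr ?_ ^ _ * ?_ ^ _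
        · exact le_of_eq (by field_simp; ring)
        · calc
            1 + 2 * (B ^ 2 / lam) / (ε / 2) ^ 2 = 1 + 8 * B ^ 2 * 1 / (lam * ε ^ 2) := by
              field_simp
              ring
            _ ≤ _ := by gcongr
  · obtain ⟨z, hz, hyz⟩ := hN y hy
    obtain ⟨U, hU, hYU⟩ := hM _ hY
    refine ⟨V (z, U), Finset.mem_image_of_mem V (Finset.mk_mem_product hz hU), fun s => ?_⟩
    refine (abs_min_sub_min_le_max _ _ _ _).trans (max_le ?_ (by simpa using hε.le))
    refine Real.abs_iSup_sub_iSup_le (bddAbove_range_inner_add_sqrt (hφ s) _ _)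
      (bddAbove_range_inner_add_sqrt (hφ s) _ _) fun a => ?_
    refine (abs_inner_add_sqrt_sub_le (hφ s a) _ _ _ _).trans ?_
    have := Real.sqrt_le_left (half_pos hε).le |>.2 hYU
    linarith
end
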